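/- Fix τ ∈ ℂ with Im τ > 0 and an integer n ≥ 2. Then for every z ∈ ℂ, θ₁(nz|nτ) = (n·θ₁′(0|nτ) / (θ₁′(0|τ) · ∏_{k=1}^{n-1} θ₁(kπ/n|τ))) · ∏_{k=0}^{n-1} θ₁(z + kπ/n|τ). -/

import Mathlib

/-- Jacobi theta function θ₁(z|τ), nome q = exp(iπτ). -/
noncomputable def theta1 (z τ : ℂ) : ℂ :=
  2 * ∑' n : ℕ, (-1) ^ n * Complex.exp (Real.pi * Complex.I * τ * ((n : ℂ) + 1 / 2) ^ 2) *
      Complex.sin ((2 * (n : ℂ) + 1) * z)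

/-- θ₁′(0|τ), the z-derivative of θ₁ at 0. -/
noncomputable def theta1deriv (τ : ℂ) : ℂ :=
  2 * ∑' n : ℕ, (-1) ^ n * (2 * (n : ℂ) + 1) *
      Complex.exp (Real.pi * Complex.I * τ * ((n : ℂ) + 1 / 2) ^ 2)

/-- The Euler product `∏ₘ (1 - Qᵐ x)`. -/
noncomputable def eulerProd (Q x : ℂ) : ℂ := ∏' m : ℕ, (1 + -(Q ^ m * x))

theorem summable_norm_eulerProd {Q : ℂ} (hQ : ‖Q‖ < 1) (x : ℂ) :
    Summable fun m : ℕ ↦ ‖-(Q ^ m * x)‖ := by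
  simpa using (summable_geometric_of_lt_one (norm_nonneg _) hQ).mul_right ‖x‖

theorem differentiable_eulerProd {Q : ℂ} (hQ : ‖Q‖ < 1) : Differentiable ℂ (eulerProd Q) := by
  intro x
  have hu : Summable fun m : ℕ ↦ ‖Q‖ ^ m * (‖x‖ + 1) :=
    (summable_geometric_of_lt_one (norm_nonneg _) hQ).mul_right _
  have hprod := hu.hasProdLocallyUniformlyOn_nat_one_add
    (f := fun (m : ℕ) (y : ℂ) ↦ -(Q ^ m * y)) (Metric.isOpen_ball (x := x) (ε := 1))
    (.of_forall fun m y hy ↦ by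
      have : ‖y‖ ≤ ‖x‖ + 1 := by
        have h1 := norm_le_norm_add_norm_sub x y
        rw [Metric.mem_ball, dist_eq_norm, norm_sub_rev] at hy
        rw [norm_sub_rev] at h1 hy
        linarith
      rw [norm_neg, norm_mul, norm_pow]
      gcongr)
    (fun m ↦ by fun_prop)
  have hd : DifferentiableOn ℂ (eulerProd Q) (Metric.ball x 1) :=
    hprod.differentiableOn
      (.of_forall fun _ ↦ by
        simpa [Finset.prod_fn] using DifferentiableOn.finsetProd (fun _ _ ↦ by fun_prop))
      Metric.isOpen_ball
  exact hd.differentiableAt (Metric.ball_mem_nhds x one_pos)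

theorem eulerProd_eq {Q : ℂ} (hQ : ‖Q‖ < 1) (x : ℂ) :
    eulerProd Q x = (1 - x) * eulerProd Q (Q * x) := by
  have hshift : (fun m : ℕ ↦ 1 + -(Q ^ (m + 1) * x)) = fun m : ℕ ↦ 1 + -(Q ^ m * (Q * x)) := by
    ext m
    ring
  have h : Multipliable fun m : ℕ ↦ 1 + -(Q ^ (m + 1) * x) :=
    hshift ▸ multipliable_one_add_of_summable (summable_norm_eulerProd hQ (Q * x))
  have h' := tprod_eq_zero_mul' (f := fun m : ℕ ↦ 1 + -(Q ^ m * x)) h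
  rw [hshift, pow_zero, one_mul, ← sub_eq_add_neg] at h'
  exact h'

theorem exists_of_eulerProd_eq_zero {Q : ℂ} (hQ : ‖Q‖ < 1) {x : ℂ} (h : eulerProd Q x = 0) :
    ∃ m : ℕ, Q ^ m * x = 1 := by
  by_contra! hne
  refine tprod_one_add_ne_zero_of_summable (fun m ↦ ?_) (summable_norm_eulerProd hQ x) h
  rw [← sub_eq_add_neg, sub_ne_zero]
  exact (hne m).symm

theorem eulerProd_ne_zero {Q x : ℂ} (hQ : ‖Q‖ < 1) (hx : ‖x‖ < 1) : eulerProd Q x ≠ 0 := by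
  intro h
  obtain ⟨m, hm⟩ := exists_of_eulerProd_eq_zero hQ h
  have h1 : ‖Q ^ m * x‖ < 1 := by
    rw [norm_mul, norm_pow]
    exact (mul_le_of_le_one_left (norm_nonneg _)
      (pow_le_one₀ (norm_nonneg _) hQ.le)).trans_lt hx
  simp [hm] at h1

/-- A multiple of `θ₁(·|τ)`, given by its product expansion. -/
noncomputable def thetaProd (τ z : ℂ) : ℂ :=
  Complex.exp (-(Complex.I * z)) *
    eulerProd (Complex.exp (2 * Real.pi * Complex.I * τ)) (Complex.exp (2 * Complex.I * z)) *
    eulerProd (Complex.exp (2 * Real.pi * Complex.I * τ))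
      (Complex.exp (2 * Real.pi * Complex.I * τ) * Complex.exp (-(2 * Complex.I * z)))

open Complex in
theorem norm_exp_two_pi_I_mul_lt_one {τ : ℂ} (hτ : 0 < τ.im) :
    ‖exp (2 * Real.pi * I * τ)‖ < 1 := by
  rw [norm_exp, Real.exp_lt_one_iff]
  have := Real.pi_pos
  simp
  positivity

open Complex in
theorem differentiable_thetaProd {τ : ℂ} (hτ : 0 < τ.im) : Differentiable ℂ (thetaProd τ) := by
  have hd := differentiable_eulerProd (norm_exp_two_pi_I_mul_lt_one hτ)
  unfold thetaProd
  refine (Differentiable.mul (by fun_prop) (hd.comp (by fun_prop))).mul (hd.comp (by fun_prop))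

open Complex in
theorem thetaProd_add_pi (τ z : ℂ) : thetaProd τ (z + Real.pi) = -thetaProd τ z := by
  have h1 : exp (-(I * (z + Real.pi))) = -exp (-(I * z)) := by
    rw [mul_add, neg_add, exp_add, mul_comm I (Real.pi : ℂ), exp_neg (Real.pi * I), exp_pi_mul_I]
    norm_num
  have h2 : exp (2 * I * (z + Real.pi)) = exp (2 * I * z) := by
    rw [← exp_periodic (2 * I * z)]
    ring_nf
  have h3 : exp (-(2 * I * (z + Real.pi))) = exp (-(2 * I * z)) := by
    rw [exp_neg, h2, exp_neg]
  rw [thetaProd, h1, h2, h3, thetaProd]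
  ring

open Complex in
theorem thetaProd_add_pi_mul {τ : ℂ} (hτ : 0 < τ.im) (z : ℂ) :
    thetaProd τ (z + Real.pi * τ) =
      -exp (-(Real.pi * I * τ) - 2 * I * z) * thetaProd τ z := by
  have hQ := norm_exp_two_pi_I_mul_lt_one hτ
  have h2 : exp (2 * I * (z + Real.pi * τ)) = exp (2 * Real.pi * I * τ) * exp (2 * I * z) := by
    rw [← exp_add]; ring_nf
  have h3 : exp (2 * Real.pi * I * τ) * exp (-(2 * I * (z + Real.pi * τ))) =
      exp (-(2 * I * z)) := by
    rw [← exp_add]; ring_nf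
  have h4 : exp (-(I * (z + Real.pi * τ))) = exp (-(Real.pi * I * τ)) * exp (-(I * z)) := by
    rw [← exp_add]; ring_nf
  have h5 : exp (-(2 * I * z)) * exp (2 * I * z) = 1 := by rw [← exp_add]; simp
  rw [thetaProd, h2, h3, h4, eulerProd_eq hQ (exp (-(2 * I * z))), thetaProd,
    eulerProd_eq hQ (exp (2 * I * z)), sub_eq_add_neg (-(Real.pi * I * τ)), exp_add]
  linear_combination
    (-exp (-(Real.pi * I * τ)) * exp (-(I * z)) *
      eulerProd (exp (2 * Real.pi * I * τ)) (exp (2 * Real.pi * I * τ) * exp (2 * I * z)) *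
      eulerProd (exp (2 * Real.pi * I * τ)) (exp (2 * Real.pi * I * τ) * exp (-(2 * I * z)))) * h5

open Complex in
theorem exists_of_thetaProd_eq_zero {τ : ℂ} (hτ : 0 < τ.im) {z : ℂ} (h : thetaProd τ z = 0) :
    ∃ m j : ℤ, z = m * Real.pi + j * (Real.pi * τ) := by
  have hQ := norm_exp_two_pi_I_mul_lt_one hτ
  have h2I : (2 * I : ℂ) ≠ 0 := by simp
  rw [thetaProd, mul_eq_zero, mul_eq_zero] at h
  rcases h with (h | h) | h
  · exact absurd h (exp_ne_zero _)
  · obtain ⟨j, hj⟩ := exists_of_eulerProd_eq_zero hQ h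
    rw [← exp_nat_mul, ← exp_add, exp_eq_one_iff] at hj
    obtain ⟨m, hm⟩ := hj
    refine ⟨m, -j, mul_left_cancel₀ h2I ?_⟩
    push_cast
    linear_combination hm
  · obtain ⟨j, hj⟩ := exists_of_eulerProd_eq_zero hQ h
    rw [← mul_assoc, ← pow_succ, ← exp_nat_mul, ← exp_add, exp_eq_one_iff] at hj
    obtain ⟨m, hm⟩ := hj
    refine ⟨-m, j + 1, mul_left_cancel₀ h2I ?_⟩
    push_cast at hm ⊢
    linear_combination -hm

open Complex in
theorem thetaProd_zero {τ : ℂ} (hτ : 0 < τ.im) : thetaProd τ 0 = 0 := by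
  have hQ := norm_exp_two_pi_I_mul_lt_one hτ
  simp [thetaProd, eulerProd_eq hQ 1]

open Complex in
theorem deriv_thetaProd_zero_ne_zero {τ : ℂ} (hτ : 0 < τ.im) : deriv (thetaProd τ) 0 ≠ 0 := by
  have hQ := norm_exp_two_pi_I_mul_lt_one hτ
  have hd := differentiable_eulerProd hQ
  set Q := exp (2 * Real.pi * I * τ) with hQdef
  let H : ℂ → ℂ := fun z ↦ eulerProd Q (Q * exp (2 * I * z)) * eulerProd Q (Q * exp (-(2 * I * z)))
  have hH : Differentiable ℂ H := (hd.comp (by fun_prop)).mul (hd.comp (by fun_prop))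
  have heq : thetaProd τ = fun z ↦ (exp (-(I * z)) - exp (I * z)) * H z := by
    ext z
    have : exp (-(I * z)) * exp (2 * I * z) = exp (I * z) := by rw [← exp_add]; ring_nf
    rw [thetaProd, ← hQdef, eulerProd_eq hQ (exp (2 * I * z))]
    linear_combination -H z * this
  have hS : HasDerivAt (fun z ↦ exp (-(I * z)) - exp (I * z)) (-(2 * I)) 0 := by
    have h1 : HasDerivAt (fun z : ℂ ↦ I * z) I 0 := by
      simpa using (hasDerivAt_id (0 : ℂ)).const_mul I
    convert! h1.neg.cexp.sub h1.cexp using 1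
    simp
    ring
  have h := (hS.mul (hH 0).hasDerivAt).deriv
  have h0 : H 0 ≠ 0 := by
    have := eulerProd_ne_zero hQ hQ
    simp [H, this]
  rw [heq]
  refine ne_of_eq_of_ne h ?_
  simp [h0]

/-- A continuous function with periods `π` and `πτ`, `Im τ > 0`, is bounded. -/
theorem isBounded_range_of_doubly_periodic {τ : ℂ} (hτ : 0 < τ.im) {h : ℂ → ℂ}
    (hc : Continuous h) (h₁ : Function.Periodic h Real.pi)
    (h₂ : Function.Periodic h (Real.pi * τ)) : Bornology.IsBounded (Set.range h) := by
  have hpi := Real.pi_pos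
  refine ((isCompact_closedBall (0 : ℂ) (Real.pi + Real.pi * ‖τ‖)).image hc).isBounded.subset ?_
  rintro _ ⟨z, rfl⟩
  set t : ℝ := z.im / (Real.pi * τ.im) with ht
  set s : ℝ := (z.re - t * Real.pi * τ.re) / Real.pi with hs
  have hz : z = s * Real.pi + t * (Real.pi * τ) := by
    apply Complex.ext
    · simp [hs]
      field_simp
      ring
    · have him : z.im = t * (Real.pi * τ.im) := by
        rw [ht]
        field_simp
      simpa using him
  refine ⟨z - ⌊s⌋ * Real.pi - ⌊t⌋ * (Real.pi * τ), ?_, ?_⟩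
  · have : z - ⌊s⌋ * Real.pi - ⌊t⌋ * (Real.pi * τ) =
        ((Int.fract s : ℝ) : ℂ) * Real.pi + ((Int.fract t : ℝ) : ℂ) * (Real.pi * τ) := by
      rw [Int.fract, Int.fract]
      push_cast
      linear_combination hz
    rw [mem_closedBall_zero_iff, this]
    refine (norm_add_le _ _).trans ?_
    simp only [norm_mul, Complex.norm_real, Real.norm_eq_abs, abs_of_pos hpi, Int.abs_fract]
    have := (Int.fract_lt_one s).le
    have := (Int.fract_lt_one t).le
    exact add_le_add (mul_le_of_le_one_left hpi.le ‹_›)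
      (mul_le_of_le_one_left (by positivity) ‹_›)
  · rw [(h₂.int_mul _).sub_eq, (h₁.int_mul _).sub_eq]

open Complex Topology Filter in
/-- Entire functions vanishing at `0` with the quasi-periodicity of `θ₁(·|τ)` are multiples of
`thetaProd τ`. -/
theorem exists_eq_mul_thetaProd {τ : ℂ} (hτ : 0 < τ.im) {f : ℂ → ℂ} (hf : Differentiable ℂ f)
    (h₁ : ∀ z, f (z + Real.pi) = -f z)
    (h₂ : ∀ z, f (z + Real.pi * τ) = -exp (-(Real.pi * I * τ) - 2 * I * z) * f z)
    (h₀ : f 0 = 0) : ∃ c, ∀ z, f z = c * thetaProd τ z := by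
  set G := thetaProd τ with hG
  have hGd : Differentiable ℂ G := differentiable_thetaProd hτ
  have hG0 : G 0 = 0 := thetaProd_zero hτ
  set h : ℂ → ℂ := fun z ↦ if G z = 0 then deriv f 0 / deriv G 0 else f z / G z with hh
  have hp₁ : Function.Periodic h Real.pi := by
    intro z
    simp only [hh, hG, thetaProd_add_pi, h₁, neg_eq_zero, neg_div_neg_eq]
  have hp₂ : Function.Periodic h (Real.pi * τ) := by
    intro z
    have he := exp_ne_zero (-(Real.pi * I * τ) - 2 * I * z)
    simp only [hh, hG, thetaProd_add_pi_mul hτ, h₂, mul_eq_zero, neg_eq_zero, he, false_or,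
      mul_div_mul_left _ _ (neg_ne_zero.mpr he)]
  have hdslope {g : ℂ → ℂ} (hg : Differentiable ℂ g) : Differentiable ℂ (dslope g 0) := by
    rw [← differentiableOn_univ] at hg ⊢
    exact (Complex.differentiableOn_dslope univ_mem).mpr hg
  have hh0 : DifferentiableAt ℂ h 0 := by
    have hne : dslope G 0 0 ≠ 0 := by
      rw [dslope_same]
      exact deriv_thetaProd_zero_ne_zero hτ
    refine ((hdslope hf 0).div (hdslope hGd 0) hne).congr_of_eventuallyEq ?_
    filter_upwards [(hdslope hGd).continuous.continuousAt.eventually_ne hne] with z hz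
    rcases eq_or_ne z 0 with rfl | hz0
    · simp [hh, hG0]
    · rw [dslope_of_ne _ hz0, slope_def_field, hG0, sub_zero, sub_zero] at hz
      have hGz : G z ≠ 0 := fun h ↦ hz (by simp [h])
      simp only [hh, if_neg hGz, Pi.div_apply, dslope_of_ne _ hz0, slope_def_field, hG0, h₀,
        sub_zero]
      field_simp
  have hhd : Differentiable ℂ h := by
    intro z
    by_cases hz : G z = 0
    · obtain ⟨m, j, hmj⟩ := exists_of_thetaProd_eq_zero hτ hz
      have hcomp : h = fun w ↦ h (w - z) := by
        ext w
        rw [hmj, ← sub_sub, (hp₂.int_mul _).sub_eq, (hp₁.int_mul _).sub_eq]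
      rw [hcomp]
      exact DifferentiableAt.comp z (g := h) (f := fun w ↦ w - z) (by simpa using hh0) (by fun_prop)
    · refine ((hf z).div (hGd z) hz).congr_of_eventuallyEq ?_
      filter_upwards [hGd.continuous.continuousAt.eventually_ne hz] with w hw
      simp [hh, hw]
  have hconst := hhd.apply_eq_apply_of_bounded
    (isBounded_range_of_doubly_periodic hτ hhd.continuous hp₁ hp₂)
  refine ⟨h 0, fun z ↦ ?_⟩
  by_cases hz : G z = 0
  · have hfz : f z = 0 := by
      obtain ⟨m, j, rfl⟩ := exists_of_thetaProd_eq_zero hτ hz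
      have hq₁ : Function.Periodic (fun w ↦ f w = 0) Real.pi := fun w ↦ by simp [h₁]
      have hq₂ : Function.Periodic (fun w ↦ f w = 0) (Real.pi * τ) := fun w ↦ by
        simp [h₂]
      refine ((hq₂.int_mul j) (m * Real.pi)).mpr ?_
      rw [← zero_add (m * (Real.pi : ℂ))]
      exact ((hq₁.int_mul m) 0).mpr h₀
    rw [hfz, hz, mul_zero]
  · rw [hconst 0 z]
    simp only [hh, if_neg hz]
    field_simp

open Complex in
theorem jacobiTheta₂_term_natCast (z τ : ℂ) (n : ℕ) :
    exp (Real.pi * I * τ / 4) * exp (I * z) *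
        jacobiTheta₂_term n (z / Real.pi + 1 / 2 + τ / 2) τ =
      (-1) ^ n * exp (Real.pi * I * τ * ((n : ℂ) + 1 / 2) ^ 2) *
        exp ((2 * (n : ℂ) + 1) * z * I) := by
  have hpi : (Real.pi : ℂ) ≠ 0 := ofReal_ne_zero.mpr Real.pi_ne_zero
  have hs : (-1 : ℂ) ^ n = exp (n * (Real.pi * I)) := by rw [exp_nat_mul, exp_pi_mul_I]
  rw [hs, jacobiTheta₂_term, ← exp_add, ← exp_add, ← exp_add, ← exp_add]
  congr 1
  push_cast
  field_simp
  ring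

open Complex in
theorem jacobiTheta₂_term_neg_add_one (z τ : ℂ) (n : ℕ) :
    exp (Real.pi * I * τ / 4) * exp (I * z) *
        jacobiTheta₂_term (-(n + 1)) (z / Real.pi + 1 / 2 + τ / 2) τ =
      -((-1) ^ n * exp (Real.pi * I * τ * ((n : ℂ) + 1 / 2) ^ 2) *
        exp (-((2 * (n : ℂ) + 1) * z) * I)) := by
  have hpi : (Real.pi : ℂ) ≠ 0 := ofReal_ne_zero.mpr Real.pi_ne_zero
  have hs : (-1 : ℂ) ^ n = -exp (-(n + 1) * (Real.pi * I)) := by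
    rw [add_comm, neg_add, add_mul, exp_add, neg_one_mul, exp_neg (Real.pi * I), exp_pi_mul_I,
      neg_mul, exp_neg, exp_nat_mul, exp_pi_mul_I, ← inv_pow]
    norm_num
  rw [hs, jacobiTheta₂_term, neg_mul, neg_mul, neg_neg, ← exp_add, ← exp_add, ← exp_add,
    ← exp_add]
  congr 1
  push_cast
  field_simp
  ring

open Complex in
theorem theta1_eq_jacobiTheta₂ {τ : ℂ} (hτ : 0 < τ.im) (z : ℂ) :
    theta1 z τ = -I * exp (Real.pi * I * τ / 4) * exp (I * z) *
      jacobiTheta₂ (z / Real.pi + 1 / 2 + τ / 2) τ := by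
  have h := ((hasSum_jacobiTheta₂_term (z / Real.pi + 1 / 2 + τ / 2) hτ).nat_add_neg_add_one).mul_left
    (-I * exp (Real.pi * I * τ / 4) * exp (I * z))
  rw [← h.tsum_eq, theta1, ← tsum_mul_left]
  refine tsum_congr fun n ↦ ?_
  rw [sin]
  linear_combination I * (jacobiTheta₂_term_natCast z τ n + jacobiTheta₂_term_neg_add_one z τ n)

open Complex in
theorem hasDerivAt_theta1_zero {τ : ℂ} (hτ : 0 < τ.im) :
    HasDerivAt (theta1 · τ) (theta1deriv τ) 0 := by
  have hpi : (Real.pi : ℂ) ≠ 0 := ofReal_ne_zero.mpr Real.pi_ne_zero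
  set w : ℂ := 0 / Real.pi + 1 / 2 + τ / 2 with hw
  have hJ : HasDerivAt (fun z : ℂ ↦ jacobiTheta₂ (z / Real.pi + 1 / 2 + τ / 2) τ)
      (jacobiTheta₂' w τ * (1 / Real.pi)) 0 := by
    refine HasDerivAt.comp (h₂ := (jacobiTheta₂ · τ)) (0 : ℂ) (hasDerivAt_jacobiTheta₂_fst w hτ) ?_
    exact (((hasDerivAt_id (0 : ℂ)).div_const _).add_const _).add_const _
  have hE : HasDerivAt (fun z : ℂ ↦ -I * exp (Real.pi * I * τ / 4) * exp (I * z))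
      (-I * exp (Real.pi * I * τ / 4) * I) 0 := by
    have h1 : HasDerivAt (fun z : ℂ ↦ I * z) I 0 := by
      simpa using (hasDerivAt_id (0 : ℂ)).const_mul I
    simpa using h1.cexp.const_mul (-I * exp (Real.pi * I * τ / 4))
  have hfun : (theta1 · τ) = fun z ↦ -I * exp (Real.pi * I * τ / 4) * exp (I * z) *
      jacobiTheta₂ (z / Real.pi + 1 / 2 + τ / 2) τ := funext (theta1_eq_jacobiTheta₂ hτ)
  rw [hfun]
  refine (hE.mul hJ).congr_deriv ?_
  rw [← hw]
  have hsum := (((hasSum_jacobiTheta₂_term w hτ).mul_left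
      (-I * exp (Real.pi * I * τ / 4) * I)).add
    ((hasSum_jacobiTheta₂'_term w hτ).mul_left
      (-I * exp (Real.pi * I * τ / 4) * (1 / Real.pi)))).nat_add_neg_add_one
  have hval : -I * exp (Real.pi * I * τ / 4) * I * jacobiTheta₂ w τ +
      -I * exp (Real.pi * I * τ / 4) * exp (I * 0) * (jacobiTheta₂' w τ * (1 / Real.pi)) =
      -I * exp (Real.pi * I * τ / 4) * I * jacobiTheta₂ w τ +
      -I * exp (Real.pi * I * τ / 4) * (1 / Real.pi) * jacobiTheta₂' w τ := by
    rw [mul_zero, exp_zero]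
    ring
  rw [hval, ← hsum.tsum_eq, theta1deriv, ← tsum_mul_left]
  refine tsum_congr fun n ↦ ?_
  have hd (m : ℤ) : 1 / Real.pi * jacobiTheta₂'_term m w τ = 2 * I * m * jacobiTheta₂_term m w τ := by
    rw [jacobiTheta₂'_term]
    field_simp
  have hd₁ := hd n
  have hd₂ := hd (-(n + 1))
  have e₁ := jacobiTheta₂_term_natCast 0 τ n
  have e₂ := jacobiTheta₂_term_neg_add_one 0 τ n
  simp only [← hw, mul_zero, neg_zero, zero_mul, exp_zero, mul_one] at e₁ e₂
  push_cast at hd₁ hd₂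
  linear_combination (-I * exp (Real.pi * I * τ / 4)) * (hd₁ + hd₂) -
    I ^ 2 * (2 * n + 1) * (e₁ - e₂) -
    (2 * (2 * n + 1) * ((-1) ^ n * exp (Real.pi * I * τ * ((n : ℂ) + 1 / 2) ^ 2))) * I_sq

open Complex in
theorem differentiable_theta1 {τ : ℂ} (hτ : 0 < τ.im) : Differentiable ℂ (theta1 · τ) := by
  rw [funext (theta1_eq_jacobiTheta₂ hτ)]
  refine Differentiable.mul (by fun_prop) fun z ↦ ?_
  exact DifferentiableAt.comp z (differentiableAt_jacobiTheta₂_fst _ hτ)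
    (f := fun z ↦ z / Real.pi + 1 / 2 + τ / 2) (by fun_prop)

theorem theta1_zero (τ : ℂ) : theta1 0 τ = 0 := by simp [theta1]

open Complex in
theorem theta1_add_pi {τ : ℂ} (hτ : 0 < τ.im) (z : ℂ) :
    theta1 (z + Real.pi) τ = -theta1 z τ := by
  have hpi : (Real.pi : ℂ) ≠ 0 := ofReal_ne_zero.mpr Real.pi_ne_zero
  have h1 : (z + Real.pi) / Real.pi + 1 / 2 + τ / 2 = z / Real.pi + 1 / 2 + τ / 2 + 1 := by
    field_simp
    ring
  rw [theta1_eq_jacobiTheta₂ hτ, theta1_eq_jacobiTheta₂ hτ, h1, jacobiTheta₂_add_left, mul_add,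
    exp_add, mul_comm I (Real.pi : ℂ), exp_pi_mul_I]
  ring

open Complex in
theorem theta1_add_pi_mul {τ : ℂ} (hτ : 0 < τ.im) (z : ℂ) :
    theta1 (z + Real.pi * τ) τ = -exp (-(Real.pi * I * τ) - 2 * I * z) * theta1 z τ := by
  have hpi : (Real.pi : ℂ) ≠ 0 := ofReal_ne_zero.mpr Real.pi_ne_zero
  have h1 : (z + Real.pi * τ) / Real.pi + 1 / 2 + τ / 2 = z / Real.pi + 1 / 2 + τ / 2 + τ := by
    field_simp
    ring
  have h2 : exp (I * (z + Real.pi * τ)) *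
      exp (-Real.pi * I * (τ + 2 * (z / Real.pi + 1 / 2 + τ / 2))) =
      -exp (-(Real.pi * I * τ) - 2 * I * z) * exp (I * z) := by
    have h3 : (-1 : ℂ) = exp (-(Real.pi * I)) := by
      rw [exp_neg, exp_pi_mul_I]
      norm_num
    rw [← neg_one_mul (exp (_ - _)), h3, ← exp_add, ← exp_add, ← exp_add]
    congr 1
    field_simp
    ring
  rw [theta1_eq_jacobiTheta₂ hτ, theta1_eq_jacobiTheta₂ hτ, h1, jacobiTheta₂_add_left']
  linear_combination
    (-I * exp (Real.pi * I * τ / 4) * jacobiTheta₂ (z / Real.pi + 1 / 2 + τ / 2) τ) * h2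

open Complex in
/-- The constant Fourier coefficient of the Jacobi theta function is `1`. -/
theorem integral_jacobiTheta₂ {τ : ℂ} (hτ : 0 < τ.im) :
    ∫ x in (0 : ℝ)..1, jacobiTheta₂ x τ = 1 := by
  let f : ℤ → C(ℝ, ℂ) := fun n ↦ ⟨fun x ↦ jacobiTheta₂_term n x τ, by
    unfold jacobiTheta₂_term
    fun_prop⟩
  have hnorm (n : ℤ) (x : ℝ) : ‖f n x‖ = ‖jacobiTheta₂_term n 0 τ‖ := by
    simp [f, norm_jacobiTheta₂_term]
  have hs : Summable fun n ↦ ‖(f n).restrict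
      (⟨Set.uIcc 0 1, isCompact_uIcc⟩ : TopologicalSpace.Compacts ℝ)‖ := by
    refine Summable.of_nonneg_of_le (fun _ ↦ norm_nonneg _) (fun n ↦ ?_)
      ((summable_jacobiTheta₂_term_iff 0 τ).mpr hτ).norm
    rw [ContinuousMap.norm_le _ (norm_nonneg _)]
    exact fun x ↦ (hnorm n x).le
  have h := intervalIntegral.hasSum_intervalIntegral_of_summable_norm hs
  have hterm (n : ℤ) : ∫ x in (0 : ℝ)..1, f n x = if n = 0 then 1 else 0 := by
    split_ifs with hn
    · simp [f, hn, jacobiTheta₂_term]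
    · have hc : (2 * Real.pi * I * n : ℂ) ≠ 0 := by simp [hn, Real.pi_ne_zero]
      simp only [f, ContinuousMap.coe_mk, jacobiTheta₂_term, exp_add]
      rw [intervalIntegral.integral_mul_const, integral_exp_mul_complex hc]
      have := exp_int_mul_two_pi_mul_I n
      rw [mul_comm] at this
      simp [this]
  simp only [hterm] at h
  exact h.unique (hasSum_ite_eq 0 1)

theorem exists_theta1_ne_zero {τ : ℂ} (hτ : 0 < τ.im) : ∃ z, theta1 z τ ≠ 0 := by
  by_contra! h
  have hpi : (Real.pi : ℂ) ≠ 0 := Complex.ofReal_ne_zero.mpr Real.pi_ne_zero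
  have hJ (x : ℂ) : jacobiTheta₂ x τ = 0 := by
    have hx : (x - 1 / 2 - τ / 2) * Real.pi / Real.pi + 1 / 2 + τ / 2 = x := by
      field_simp
      ring
    have h' := h ((x - 1 / 2 - τ / 2) * Real.pi)
    rw [theta1_eq_jacobiTheta₂ hτ, hx] at h'
    simpa using h'
  simpa [hJ] using integral_jacobiTheta₂ hτ

theorem exists_theta1_eq_mul_thetaProd {τ : ℂ} (hτ : 0 < τ.im) :
    ∃ c ≠ 0, ∀ z, theta1 z τ = c * thetaProd τ z := by
  obtain ⟨c, hc⟩ := exists_eq_mul_thetaProd hτ (differentiable_theta1 hτ) (theta1_add_pi hτ)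
    (theta1_add_pi_mul hτ) (theta1_zero τ)
  refine ⟨c, ?_, hc⟩
  rintro rfl
  obtain ⟨z, hz⟩ := exists_theta1_ne_zero hτ
  exact hz (by simpa using hc z)

/-- The zeros of `θ₁(·|τ)` lie in the lattice `πℤ + πτℤ`. -/
theorem exists_of_theta1_eq_zero {τ : ℂ} (hτ : 0 < τ.im) {z : ℂ} (h : theta1 z τ = 0) :
    ∃ m j : ℤ, z = m * Real.pi + j * (Real.pi * τ) := by
  obtain ⟨c, hc, hθ⟩ := exists_theta1_eq_mul_thetaProd hτ
  rw [hθ, mul_eq_zero, or_iff_right hc] at h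
  exact exists_of_thetaProd_eq_zero hτ h

theorem theta1deriv_ne_zero {τ : ℂ} (hτ : 0 < τ.im) : theta1deriv τ ≠ 0 := by
  obtain ⟨c, hc, hθ⟩ := exists_theta1_eq_mul_thetaProd hτ
  rw [← (hasDerivAt_theta1_zero hτ).deriv, funext hθ,
    deriv_const_mul _ (differentiable_thetaProd hτ 0)]
  exact mul_ne_zero hc (deriv_thetaProd_zero_ne_zero hτ)

theorem theta1_natCast_mul_pi_div_ne_zero {τ : ℂ} (hτ : 0 < τ.im) {n k : ℕ} (hk : 0 < k)
    (hkn : k < n) : theta1 ((k : ℂ) * Real.pi / n) τ ≠ 0 := by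
  intro h
  obtain ⟨m, j, hmj⟩ := exists_of_theta1_eq_zero hτ h
  have hn : (n : ℝ) ≠ 0 := by
    have : 0 < n := by omega
    positivity
  have hmj' : (((k : ℝ) * Real.pi / n : ℝ) : ℂ) =
      ((m : ℝ) : ℂ) * (Real.pi : ℝ) + ((j : ℝ) : ℂ) * ((Real.pi : ℝ) * τ) := by
    push_cast
    exact hmj
  have him := congrArg Complex.im hmj'
  have hre := congrArg Complex.re hmj'
  have hj : (j : ℝ) = 0 := by
    simpa [Real.pi_ne_zero, hτ.ne'] using him
  rw [hj] at hre
  simp at hre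
  have hkm : (k : ℝ) = m * n := by
    have := Real.pi_ne_zero
    field_simp at hre
    linarith
  have hkm' : (k : ℤ) = m * n := by exact_mod_cast hkm
  have hdvd : n ∣ k := Int.natCast_dvd_natCast.mp (Dvd.intro_left m hkm'.symm)
  exact absurd (Nat.le_of_dvd hk hdvd) (by omega)

open Complex in
/-- The product of the translates of `θ₁(·|τ)` is a multiple of `z ↦ θ₁(nz|nτ)`. -/
theorem exists_prod_theta1_eq {τ : ℂ} (hτ : 0 < τ.im) {n : ℕ} (hn : 0 < n) :
    ∃ c, ∀ z, ∏ k ∈ Finset.range n, theta1 (z + (k : ℂ) * (Real.pi : ℂ) / n) τ =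
      c * theta1 (n * z) (n * τ) := by
  have hn0 : (n : ℂ) ≠ 0 := by exact_mod_cast hn.ne'
  have hnτ : 0 < ((n : ℂ) * τ).im := by
    rw [← ofReal_natCast, im_ofReal_mul]
    positivity
  have hθ := differentiable_theta1 hτ
  let P : ℂ → ℂ := fun z ↦ ∏ k ∈ Finset.range n, theta1 (z + (k : ℂ) * (Real.pi : ℂ) / n) τ
  have hPd : Differentiable ℂ P := Differentiable.fun_finsetProd fun k _ ↦
    hθ.comp (f := fun z ↦ z + (k : ℂ) * (Real.pi : ℂ) / n) (by fun_prop)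
  have hP₁ (z : ℂ) : P (z + Real.pi / n) = -P z := by
    obtain ⟨m, rfl⟩ := Nat.exists_eq_add_of_lt hn
    simp only [zero_add] at hn0 ⊢
    have hlast : z + Real.pi / ((m + 1 : ℕ) : ℂ) + m * Real.pi / ((m + 1 : ℕ) : ℂ) =
        z + (0 : ℕ) * Real.pi / ((m + 1 : ℕ) : ℂ) + Real.pi := by
      push_cast at hn0 ⊢
      field_simp
      ring
    simp only [P, zero_add]
    rw [Finset.prod_range_succ, Finset.prod_range_succ', hlast, theta1_add_pi hτ, mul_neg]
    congr 2
    refine Finset.prod_congr rfl fun k _ ↦ ?_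
    congr 1
    push_cast
    ring
  have hP₂ (z : ℂ) : P (z + Real.pi * τ) =
      -exp (-(Real.pi * I * (n * τ)) - 2 * I * (n * z)) * P z := by
    have hsum : ∑ k ∈ Finset.range n, (-(Real.pi * I * τ) - 2 * I * (z + k * Real.pi / n) +
        Real.pi * I) = -(Real.pi * I * (n * τ)) - 2 * I * (n * z) + Real.pi * I := by
      have hgauss : (∑ k ∈ Finset.range n, (k : ℂ)) * 2 = n * (n - 1) := by
        have := Finset.sum_range_id_mul_two n
        rw [← Nat.cast_sum]
        have h' : ((n - 1 : ℕ) : ℂ) = n - 1 := Nat.cast_pred hn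
        rw [← h']
        exact_mod_cast this
      have hterm (k : ℕ) : -(Real.pi * I * τ) - 2 * I * (z + k * Real.pi / n) + Real.pi * I =
          (-(Real.pi * I * τ) - 2 * I * z + Real.pi * I) + (-(2 * I * Real.pi / n)) * k := by
        ring
      simp only [hterm]
      rw [Finset.sum_add_distrib, ← Finset.mul_sum, Finset.sum_const, Finset.card_range,
        nsmul_eq_mul]
      field_simp
      linear_combination -Real.pi * hgauss
    have hneg (w : ℂ) : -exp w = exp (w + Real.pi * I) := by
      rw [exp_add, exp_pi_mul_I, mul_neg_one]
    rw [hneg, ← hsum, exp_sum, ← Finset.prod_mul_distrib]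
    refine Finset.prod_congr rfl fun k _ ↦ ?_
    rw [← hneg, ← theta1_add_pi_mul hτ]
    ring_nf
  have hP₀ : P 0 = 0 := Finset.prod_eq_zero (Finset.mem_range.mpr hn) (by simp [theta1_zero])
  obtain ⟨a, ha⟩ := exists_eq_mul_thetaProd hnτ (f := fun w ↦ P (w / n))
    (hPd.comp (f := fun w ↦ w / (n : ℂ)) (by fun_prop))
    (fun z ↦ by rw [add_div, hP₁])
    (fun z ↦ by
      have h : (z + Real.pi * (n * τ)) / n = z / n + Real.pi * τ := by field_simp
      rw [h, hP₂, mul_div_cancel₀ _ hn0])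
    (by rw [zero_div, hP₀])
  obtain ⟨b, hb, hθ'⟩ := exists_theta1_eq_mul_thetaProd hnτ
  refine ⟨a / b, fun z ↦ ?_⟩
  have haz := ha (n * z)
  rw [mul_div_cancel_left₀ _ hn0] at haz
  change P z = _
  rw [haz, hθ']
  field_simp

/-- n-tuple rule: θ₁(nz|nτ) as a product of θ₁(z + kπ/n|τ). -/
theorem theta1_ntuple (τ : ℂ) (hτ : 0 < τ.im) (n : ℕ) (hn : 2 ≤ n) (z : ℂ) :
    theta1 ((n : ℂ) * z) ((n : ℂ) * τ) =
      (n : ℂ) * theta1deriv ((n : ℂ) * τ) /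
          (theta1deriv τ * ∏ k ∈ Finset.Icc 1 (n - 1), theta1 ((k : ℂ) * (Real.pi : ℂ) / n) τ) *
        ∏ k ∈ Finset.range n, theta1 (z + (k : ℂ) * (Real.pi : ℂ) / n) τ := by
  have hn' : 0 < n := by omega
  have hn0 : (n : ℂ) ≠ 0 := by exact_mod_cast hn'.ne'
  have hnτ : 0 < ((n : ℂ) * τ).im := by
    rw [← Complex.ofReal_natCast, Complex.im_ofReal_mul]
    positivity
  obtain ⟨c, hc⟩ := exists_prod_theta1_eq hτ hn'
  have hrange : Finset.range n = insert 0 (Finset.Icc 1 (n - 1)) := by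
    ext k
    simp only [Finset.mem_range, Finset.mem_insert, Finset.mem_Icc]
    omega
  have h0 : (0 : ℕ) ∉ Finset.Icc 1 (n - 1) := by simp
  set D := ∏ k ∈ Finset.Icc 1 (n - 1), theta1 ((k : ℂ) * (Real.pi : ℂ) / n) τ with hD
  have hD0 : D ≠ 0 := by
    refine Finset.prod_ne_zero_iff.mpr fun k hk ↦ ?_
    rw [Finset.mem_Icc] at hk
    exact theta1_natCast_mul_pi_div_ne_zero hτ (by omega) (by omega)
  have hθ' := theta1deriv_ne_zero hτ
  have hderiv : theta1deriv τ * D = c * (n * theta1deriv (n * τ)) := by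
    let R : ℂ → ℂ := fun w ↦
      ∏ k ∈ Finset.Icc 1 (n - 1), theta1 (w + (k : ℂ) * (Real.pi : ℂ) / n) τ
    have hR : Differentiable ℂ R := Differentiable.fun_finsetProd fun k _ ↦
      (differentiable_theta1 hτ).comp (f := fun w ↦ w + (k : ℂ) * (Real.pi : ℂ) / n) (by fun_prop)
    have h₁ : HasDerivAt (fun w ↦ theta1 w τ * R w) (theta1deriv τ * D) 0 := by
      convert! (hasDerivAt_theta1_zero hτ).mul (hR 0).hasDerivAt using 1
      simp [R, hD, theta1_zero]
    have h₂ : HasDerivAt (fun w ↦ c * theta1 (n * w) (n * τ)) (c * (n * theta1deriv (n * τ))) 0 := by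
      have hlin : HasDerivAt (fun w : ℂ ↦ (n : ℂ) * w) n 0 := by
        simpa using (hasDerivAt_id (0 : ℂ)).const_mul (n : ℂ)
      have hθn : HasDerivAt (theta1 · (n * τ)) (theta1deriv (n * τ)) (n * 0) := by
        rw [mul_zero]
        exact hasDerivAt_theta1_zero hnτ
      rw [mul_comm (n : ℂ) (theta1deriv _)]
      exact (HasDerivAt.comp (0 : ℂ) hθn hlin).const_mul c
    refine h₁.unique ?_
    convert! h₂ using 1
    ext w
    rw [← hc, hrange, Finset.prod_insert h0]
    simp [R]
  have hne : c * (n * theta1deriv (n * τ)) ≠ 0 := hderiv ▸ mul_ne_zero hθ' hD0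
  have hc0 : c ≠ 0 := left_ne_zero_of_mul hne
  have hd0 : theta1deriv (n * τ) ≠ 0 := theta1deriv_ne_zero hnτ
  rw [hc, hderiv]
  field_simp
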